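/- Let H ≤ S_n be semiregular with orbit transversal R. Let ρ_1 and ρ_2 be incomparable nonempty finite words over {1,…,n} (neither a prefix of the other), with last letters r_1 and r_2 respectively, and let v = (ρ_1 ρ_2) be the homeomorphism of 𝔠_n that maps ρ_1 γ to ρ_2 γ and ρ_2 γ to ρ_1 γ for all γ ∈ 𝔠_n and is the identity elsewhere. Then A_{id}^{-1} ∘ v ∘ A_{id} (in left-to-right action order: first A_{id}^{-1}, then v, then A_{id}) equals the composite, in left-to-right action order, of the swap (ρ_1·A_{id} ρ_2·A_{id}), then ⌊ρ_2·A_{id}⌋_{h_{r_1}^{-1} h_{r_2}}, then ⌊ρ_1·A_{id}⌋_{h_{r_2}^{-1} h_{r_1}}; in particular, the conjugate A_{id}^{-1} ∘ v ∘ A_{id} lies in the Higman–Thompson group V_n. -/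

import Mathlib

open scoped Classical Pointwise

/-- The group of self-homeomorphisms of a topological space, with
`(f * g) x = f (g x)`. -/
instance homeoGroup (X : Type*) [TopologicalSpace X] : Group (X ≃ₜ X) where
  mul a b := b.trans a
  one := Homeomorph.refl X
  inv := Homeomorph.symm
  mul_assoc a b c := Homeomorph.ext fun _ => rfl
  one_mul a := Homeomorph.ext fun _ => rfl
  mul_one a := Homeomorph.ext fun _ => rfl
  inv_mul_cancel a := Homeomorph.ext fun x => a.symm_apply_apply x

/-- The `n`-ary Cantor space: infinite sequences over an `n`-letter alphabet. -/
abbrev Cantor (n : ℕ) := ℕ → Fin n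

/-- Prefix a sequence by a finite word. -/
def appendWord {n : ℕ} (θ : List (Fin n)) (x : Cantor n) : Cantor n :=
  fun i => if h : i < θ.length then θ.get ⟨i, h⟩ else x (i - θ.length)

/-- `x` lies in the cone `[θ]`, i.e. has `θ` as a prefix. -/
def inCone {n : ℕ} (θ : List (Fin n)) (x : Cantor n) : Prop :=
  ∀ i, (h : i < θ.length) → x i = θ.get ⟨i, h⟩

/-- A map is a prefix-substitution map if it is given by two partitions of the
Cantor space into cones `[α i]` resp. `[β i]`, replacing the prefix `α i` by `β i`. -/
def IsPrefixMap {n : ℕ} (v : Cantor n → Cantor n) : Prop :=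
  ∃ (t : ℕ) (α β : Fin t → List (Fin n)),
    (∀ x : Cantor n, ∃! i, inCone (α i) x) ∧
    (∀ x : Cantor n, ∃! i, inCone (β i) x) ∧
    ∀ (i : Fin t) (γ : Cantor n), v (appendWord (α i) γ) = appendWord (β i) γ

/-- The Higman–Thompson group `V_n`, as a subgroup of the homeomorphism group of
the `n`-ary Cantor space: the group of all prefix-substitution homeomorphisms. -/
def HigmanThompson (n : ℕ) : Subgroup (Cantor n ≃ₜ Cantor n) :=
  Subgroup.closure {v | IsPrefixMap ⇑v}

/-- A permutation group is semiregular if no nontrivial element has a fixed point. -/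
def Semiregular {n : ℕ} (G : Subgroup (Equiv.Perm (Fin n))) : Prop :=
  ∀ g ∈ G, (∃ x, g x = x) → g = 1

/-- `R` is an orbit transversal for the natural action of `H ≤ S_n` on the `n`
points: it contains exactly one point of each `H`-orbit. -/
def IsTransversal {n : ℕ} (H : Subgroup (Equiv.Perm (Fin n))) (R : Set (Fin n)) : Prop :=
  ∀ x : Fin n, ∃! r, r ∈ R ∧ ∃ h ∈ H, h x = r

/-- `hmap` assigns to each letter `i` the (unique) element `h_i` of `H` with
`i ⬝ h_i ∈ R`. -/
def IsHmap {n : ℕ} (H : Subgroup (Equiv.Perm (Fin n))) (R : Set (Fin n))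
    (hmap : Fin n → Equiv.Perm (Fin n)) : Prop :=
  ∀ i : Fin n, hmap i ∈ H ∧ hmap i i ∈ R

/-- The transducer map `A_h` on the Cantor space: the first letter is moved by
`h`, and each subsequent letter `x_{k+1}` is moved by `h_{x_k}` (here `hmap i`
plays the role of `h_i`). -/
def AFun {n : ℕ} (h : Equiv.Perm (Fin n)) (hmap : Fin n → Equiv.Perm (Fin n))
    (x : Cantor n) : Cantor n
  | 0 => h (x 0)
  | k + 1 => hmap (x k) (x (k + 1))

/-- The recursively defined inverse of the transducer map `A_h`: the first
letter of `B χ` is `χ_1 ⬝ h⁻¹`, and its `(k+1)`-st letter is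
`χ_{k+1} ⬝ (h_{y_k})⁻¹` where `y_k` is the `k`-th letter of `B χ`. -/
def BFun {n : ℕ} (h : Equiv.Perm (Fin n)) (hmap : Fin n → Equiv.Perm (Fin n))
    (x : Cantor n) : ℕ → Fin n
  | 0 => h⁻¹ (x 0)
  | k + 1 => (hmap (BFun h hmap x k))⁻¹ (x (k + 1))

/-- Auxiliary: image under the transducer `A_id` of a finite word continuing
from the previous letter `prev`. -/
def wordAAux {n : ℕ} (hmap : Fin n → Equiv.Perm (Fin n)) (prev : Fin n) :
    List (Fin n) → List (Fin n)
  | [] => []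
  | b :: bs => hmap prev b :: wordAAux hmap b bs

/-- The image `ρ ⬝ A_id` of a finite word `ρ = r₁r₂…r_k` under the transducer
`A_id`: the first letter is `r₁` and the `(j+1)`-st letter is `r_{j+1} ⬝ h_{r_j}`. -/
def wordA {n : ℕ} (hmap : Fin n → Equiv.Perm (Fin n)) : List (Fin n) → List (Fin n)
  | [] => []
  | a :: rest => a :: wordAAux hmap a rest

/-- `⌊α⌋_s` (as a function): maps `α i γ` to `α (i ⬝ s) γ`, i.e. permutes by `s`
the letter immediately following the prefix `α`, and is the identity outside the
cone `[α]`. -/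
noncomputable def floorFun {n : ℕ} (α : List (Fin n)) (s : Equiv.Perm (Fin n))
    (x : Cantor n) : Cantor n :=
  if inCone α x then fun i => if i = α.length then s (x i) else x i else x

/-- The tail of `x` after removing a prefix of length `θ.length`. -/
def shiftWord {n : ℕ} (θ : List (Fin n)) (x : Cantor n) : Cantor n :=
  fun i => x (i + θ.length)

/-- The swap `(ρ₁ ρ₂)` (as a function): maps `ρ₁ γ` to `ρ₂ γ`, maps `ρ₂ γ` to
`ρ₁ γ`, and is the identity elsewhere. -/
noncomputable def swapFun {n : ℕ} (ρ₁ ρ₂ : List (Fin n)) (x : Cantor n) : Cantor n :=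
  if inCone ρ₁ x then appendWord ρ₂ (shiftWord ρ₁ x)
  else if inCone ρ₂ x then appendWord ρ₁ (shiftWord ρ₂ x)
  else x

def consC {n : ℕ} (a : Fin n) (x : Cantor n) : Cantor n
  | 0 => a
  | k + 1 => x k

lemma appendWord_nil' {n : ℕ} (x : Cantor n) : appendWord [] x = x := by
  funext i; simp [appendWord]

lemma appendWord_cons' {n : ℕ} (a : Fin n) (l : List (Fin n)) (x : Cantor n) :
    appendWord (a :: l) x = consC a (appendWord l x) := by
  funext i
  cases i with
  | zero => simp [appendWord, consC]
  | succ k => simp [appendWord, consC]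

lemma appendWord_append' {n : ℕ} (a b : List (Fin n)) (x : Cantor n) :
    appendWord (a ++ b) x = appendWord a (appendWord b x) := by
  induction a with
  | nil => simp [appendWord_nil']
  | cons c l ih => simp [appendWord_cons', ih]

lemma inCone_append' {n : ℕ} (θ : List (Fin n)) (x : Cantor n) :
    inCone θ (appendWord θ x) := by
  intro i h; simp [appendWord, h]

lemma append_shift' {n : ℕ} (θ : List (Fin n)) (x : Cantor n) (h : inCone θ x) :
    appendWord θ (shiftWord θ x) = x := by
  funext i
  by_cases hi : i < θ.length
  · simp [appendWord, hi, h i hi]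
  · simp only [appendWord, hi, dite_false, shiftWord]
    congr 1; omega

lemma shift_append' {n : ℕ} (θ : List (Fin n)) (x : Cantor n) :
    shiftWord θ (appendWord θ x) = x := by
  funext i
  simp [appendWord, shiftWord]

lemma prefix_of_cones {n : ℕ} (a b : List (Fin n)) (x : Cantor n) (ha : inCone a x)
    (hb : inCone b x) (hl : a.length ≤ b.length) : a <+: b := by
  rw [List.prefix_iff_eq_take]
  apply List.ext_getElem
  · simp [hl]
  · intro i h1 h2
    have e1 := ha i h1
    have e2 := hb i (by omega)
    simp only [List.get_eq_getElem] at e1 e2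
    simp [← e1, ← e2]

lemma consC_eta {n : ℕ} (x : Cantor n) : ∃ i γ, x = consC i γ :=
  ⟨x 0, fun k => x (k+1), by funext k; cases k <;> rfl⟩

lemma AFun_cons {n : ℕ} (h : Equiv.Perm (Fin n)) (hmap : Fin n → Equiv.Perm (Fin n))
    (a : Fin n) (x : Cantor n) :
    AFun h hmap (consC a x) = consC (h a) (AFun (hmap a) hmap x) := by
  funext k
  match k with
  | 0 => rfl
  | 1 => rfl
  | k + 2 => rfl

lemma AFun_BFun {n : ℕ} (h : Equiv.Perm (Fin n)) (hmap : Fin n → Equiv.Perm (Fin n))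
    (x : Cantor n) : AFun h hmap (BFun h hmap x) = x := by
  funext k
  cases k <;> simp [AFun, BFun]

lemma BFun_AFun {n : ℕ} (h : Equiv.Perm (Fin n)) (hmap : Fin n → Equiv.Perm (Fin n))
    (x : Cantor n) : BFun h hmap (AFun h hmap x) = x := by
  funext k
  induction k with
  | zero => simp [AFun, BFun]
  | succ k ih => simp [AFun, BFun, ih]

lemma AFun_aux {n : ℕ} (hmap : Fin n → Equiv.Perm (Fin n)) (l : List (Fin n)) (a : Fin n)
    (x : Cantor n) : AFun (hmap a) hmap (appendWord l x) =
      appendWord (wordAAux hmap a l)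
        (AFun (hmap ((a :: l).getLast (by simp))) hmap x) := by
  induction l generalizing a with
  | nil => simp [wordAAux, appendWord_nil']
  | cons b l ih =>
    simp [wordAAux, appendWord_cons', AFun_cons, ih]

lemma AFun_word {n : ℕ} (hmap : Fin n → Equiv.Perm (Fin n)) (ρ : List (Fin n)) (hne : ρ ≠ [])
    (x : Cantor n) : AFun 1 hmap (appendWord ρ x) =
      appendWord (wordA hmap ρ) (AFun (hmap (ρ.getLast hne)) hmap x) := by
  cases ρ with
  | nil => exact absurd rfl hne
  | cons a l => simp [wordA, appendWord_cons', AFun_cons, AFun_aux]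

lemma inCone_A {n : ℕ} (hmap : Fin n → Equiv.Perm (Fin n)) (ρ : List (Fin n)) (hne : ρ ≠ [])
    (z : Cantor n) : inCone (wordA hmap ρ) (AFun 1 hmap z) ↔ inCone ρ z := by
  constructor
  · intro h
    have h1 := append_shift' _ _ h
    rw [← AFun_BFun (hmap (ρ.getLast hne)) hmap (shiftWord _ _), ← AFun_word] at h1
    have h2 := congrArg (BFun 1 hmap) h1
    rw [BFun_AFun, BFun_AFun] at h2
    rw [← h2]; exact inCone_append' _ _
  · intro h
    rw [← append_shift' _ _ h, AFun_word hmap ρ hne]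
    exact inCone_append' _ _

lemma floorFun_append {n : ℕ} (α : List (Fin n)) (s : Equiv.Perm (Fin n)) (i : Fin n)
    (x : Cantor n) : floorFun α s (appendWord α (consC i x)) = appendWord α (consC (s i) x) := by
  rw [floorFun, if_pos (inCone_append' _ _)]
  funext k
  rcases lt_trichotomy k α.length with h | h | h
  · simp [appendWord, h, h.ne]
  · simp [appendWord, h, consC]
  · have h3 : ¬ k < α.length := by omega
    obtain ⟨m, rfl⟩ : ∃ m, k = α.length + (m + 1) := ⟨k - α.length - 1, by omega⟩
    simp [appendWord, consC]

lemma floorFun_not {n : ℕ} (α : List (Fin n)) (s : Equiv.Perm (Fin n))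
    (x : Cantor n) (h : ¬ inCone α x) : floorFun α s x = x := by
  rw [floorFun, if_neg h]

lemma not_both {n : ℕ} {a b : List (Fin n)} (h1 : ¬ a <+: b) (h2 : ¬ b <+: a) (x : Cantor n)
    (ha : inCone a x) (hb : inCone b x) : False := by
  rcases le_total a.length b.length with h | h
  · exact h1 (prefix_of_cones _ _ x ha hb h)
  · exact h2 (prefix_of_cones _ _ x hb ha h)

/-- swapped value of the conjugate. -/
lemma conj_val {n : ℕ} (hmap : Fin n → Equiv.Perm (Fin n)) (ρ σ : List (Fin n)) (hne : ρ ≠ [])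
    (hne' : σ ≠ []) (i : Fin n) (γ : Cantor n) :
    ∃ j δ, appendWord (wordA hmap ρ) (consC i γ) = AFun 1 hmap (appendWord ρ (consC j δ)) ∧
      AFun 1 hmap (appendWord σ (consC j δ)) = appendWord (wordA hmap σ)
        (consC ((hmap (σ.getLast hne') * (hmap (ρ.getLast hne))⁻¹) i) γ) := by
  refine ⟨(hmap (ρ.getLast hne))⁻¹ i,
    BFun (hmap ((hmap (ρ.getLast hne))⁻¹ i)) hmap γ, ?_, ?_⟩
  · rw [AFun_word hmap ρ hne, AFun_cons, AFun_BFun]; simp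
  · rw [AFun_word hmap σ hne', AFun_cons, AFun_BFun]; simp

lemma isPrefixMap_of {n : ℕ} (w : Cantor n → Cantor n) (hw : Function.Bijective w) (N : ℕ)
    (h : ∀ α : List (Fin n), α.length = N → ∃ β, ∀ γ, w (appendWord α γ) = appendWord β γ) :
    IsPrefixMap w := by
  let e := Fintype.equivFin (Fin N → Fin n)
  choose β hβ using fun f : Fin N → Fin n => h (List.ofFn f) (by simp)
  have key : ∀ x : Cantor n, ∃! i, inCone (List.ofFn (e.symm i)) x := by
    intro x
    refine ⟨e (fun k => x k), ?_, ?_⟩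
    · intro k hk; simp
    · intro i hi
      apply e.symm_apply_eq.mp
      funext k
      have := hi k (by simp)
      simp at this
      simp [this]
  refine ⟨_, fun i => List.ofFn (e.symm i), fun i => β (e.symm i), key, ?_, ?_⟩
  · intro y
    obtain ⟨x, rfl⟩ := hw.2 y
    obtain ⟨i, hi, hu⟩ := key x
    refine ⟨i, ?_, ?_⟩
    · rw [← append_shift' _ _ hi]
      simp only [hβ]
      exact inCone_append' _ _
    · intro j hj
      apply hu
      have := append_shift' _ _ hj
      rw [← hβ] at this
      rw [← hw.1 this]
      exact inCone_append' _ _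
  · intro i γ; exact hβ _ _

/-- Let `H ≤ S_n` be semiregular with orbit transversal `R`,
and let `ρ₁, ρ₂` be incomparable nonempty finite words with last letters `r₁`,
`r₂`.  Let `v = (ρ₁ ρ₂)` be the swap of the cones `[ρ₁]` and `[ρ₂]`.  Then
`A_id⁻¹ ∘ v ∘ A_id` (apply `A_id⁻¹ = BFun`, then `v`, then `A_id`) equals the
left-to-right composite of the swap `(ρ₁⬝A_id  ρ₂⬝A_id)`, then
`⌊ρ₂⬝A_id⌋_{h_{r₁}⁻¹ h_{r₂}}`, then `⌊ρ₁⬝A_id⌋_{h_{r₂}⁻¹ h_{r₁}}`; in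
particular any homeomorphism with this underlying map lies in `V_n`. -/
theorem conj_small_swap (n : ℕ) (hn : 2 ≤ n)
    (H : Subgroup (Equiv.Perm (Fin n))) (hH : Semiregular H)
    (R : Set (Fin n)) (hR : IsTransversal H R)
    (hmap : Fin n → Equiv.Perm (Fin n)) (hhmap : IsHmap H R hmap)
    (ρ₁ ρ₂ : List (Fin n)) (hne₁ : ρ₁ ≠ []) (hne₂ : ρ₂ ≠ [])
    (hinc₁ : ¬ ρ₁ <+: ρ₂) (hinc₂ : ¬ ρ₂ <+: ρ₁)
    (r₁ r₂ : Fin n) (hr₁ : r₁ = ρ₁.getLast hne₁) (hr₂ : r₂ = ρ₂.getLast hne₂) :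
    (∀ x : Cantor n,
        AFun 1 hmap (swapFun ρ₁ ρ₂ (BFun 1 hmap x))
          = floorFun (wordA hmap ρ₁) (hmap r₁ * (hmap r₂)⁻¹)
              (floorFun (wordA hmap ρ₂) (hmap r₂ * (hmap r₁)⁻¹)
                (swapFun (wordA hmap ρ₁) (wordA hmap ρ₂) x))) ∧
      ∀ w : Cantor n ≃ₜ Cantor n,
        (⇑w = fun x => AFun 1 hmap (swapFun ρ₁ ρ₂ (BFun 1 hmap x))) →
          w ∈ HigmanThompson n := by
  have L1 : ∀ (i : Fin n) (γ : Cantor n),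
      AFun 1 hmap (swapFun ρ₁ ρ₂ (BFun 1 hmap (appendWord (wordA hmap ρ₁) (consC i γ)))) =
      appendWord (wordA hmap ρ₂) (consC ((hmap r₂ * (hmap r₁)⁻¹) i) γ) := by
    intro i γ
    obtain ⟨j, δ, e1, e2⟩ := conj_val hmap ρ₁ ρ₂ hne₁ hne₂ i γ
    rw [e1, BFun_AFun, swapFun, if_pos (inCone_append' _ _), shift_append', e2, hr₁, hr₂]
  have L2 : ∀ (i : Fin n) (γ : Cantor n),
      AFun 1 hmap (swapFun ρ₁ ρ₂ (BFun 1 hmap (appendWord (wordA hmap ρ₂) (consC i γ)))) =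
      appendWord (wordA hmap ρ₁) (consC ((hmap r₁ * (hmap r₂)⁻¹) i) γ) := by
    intro i γ
    obtain ⟨j, δ, e1, e2⟩ := conj_val hmap ρ₂ ρ₁ hne₂ hne₁ i γ
    rw [e1, BFun_AFun, swapFun,
      if_neg (fun hc => not_both hinc₁ hinc₂ _ hc (inCone_append' _ _)),
      if_pos (inCone_append' _ _), shift_append', e2, hr₁, hr₂]
  have L3 : ∀ x, ¬ inCone (wordA hmap ρ₁) x → ¬ inCone (wordA hmap ρ₂) x →
      AFun 1 hmap (swapFun ρ₁ ρ₂ (BFun 1 hmap x)) = x := by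
    intro x h1 h2
    rw [← AFun_BFun 1 hmap x, inCone_A hmap _ hne₁] at h1
    rw [← AFun_BFun 1 hmap x, inCone_A hmap _ hne₂] at h2
    rw [swapFun, if_neg h1, if_neg h2, AFun_BFun]
  have D : ∀ x, inCone (wordA hmap ρ₁) x → inCone (wordA hmap ρ₂) x → False := by
    intro x h1 h2
    rw [← AFun_BFun 1 hmap x, inCone_A hmap _ hne₁] at h1
    rw [← AFun_BFun 1 hmap x, inCone_A hmap _ hne₂] at h2
    exact not_both hinc₁ hinc₂ _ h1 h2
  constructor
  · intro x
    by_cases h1 : inCone (wordA hmap ρ₁) x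
    · have hx := append_shift' _ _ h1
      obtain ⟨i, γ, e⟩ := consC_eta (shiftWord (wordA hmap ρ₁) x)
      rw [e] at hx
      rw [← hx, L1, swapFun, if_pos (inCone_append' _ _), shift_append', floorFun_append,
        floorFun_not _ _ _ (fun hc => D _ hc (inCone_append' _ _))]
    · by_cases h2 : inCone (wordA hmap ρ₂) x
      · have hx := append_shift' _ _ h2
        obtain ⟨i, γ, e⟩ := consC_eta (shiftWord (wordA hmap ρ₂) x)
        rw [e] at hx
        rw [← hx, L2, swapFun, if_neg (fun hc => D _ hc (inCone_append' _ _)),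
          if_pos (inCone_append' _ _), shift_append',
          floorFun_not _ _ _ (fun hc => D _ (inCone_append' _ _) hc), floorFun_append]
      · rw [L3 x h1 h2, swapFun, if_neg h1, if_neg h2, floorFun_not _ _ _ h2,
          floorFun_not _ _ _ h1]
  · intro w hw
    apply Subgroup.subset_closure
    apply isPrefixMap_of _ w.bijective
      ((wordA hmap ρ₁).length + (wordA hmap ρ₂).length + 1)
    intro α hα
    rw [hw]
    by_cases h1 : wordA hmap ρ₁ <+: α
    · obtain ⟨τ, rfl⟩ := h1
      cases τ with
      | nil => simp at hα; omega
      | cons i δ =>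
        refine ⟨wordA hmap ρ₂ ++ (hmap r₂ * (hmap r₁)⁻¹) i :: δ, fun γ => ?_⟩
        simp only [appendWord_append', appendWord_cons', L1]
    · by_cases h2 : wordA hmap ρ₂ <+: α
      · obtain ⟨τ, rfl⟩ := h2
        cases τ with
        | nil => simp at hα; omega
        | cons i δ =>
          refine ⟨wordA hmap ρ₁ ++ (hmap r₁ * (hmap r₂)⁻¹) i :: δ, fun γ => ?_⟩
          simp only [appendWord_append', appendWord_cons', L2]
      · refine ⟨α, fun γ => L3 _ (fun hc => h1 ?_) (fun hc => h2 ?_)⟩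
        · exact prefix_of_cones _ _ _ hc (inCone_append' _ _) (by omega)
        · exact prefix_of_cones _ _ _ hc (inCone_append' _ _) (by omega)
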